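/- Define f : H → ℝ∪{+∞} by f((x_1,…,x_J)) := Σ_{j=1}^J ‖x_j‖_{A_j}/sqrt(K_j). Let F be a real Hilbert space and let M : H → F be a continuous linear map satisfying (1−δ)‖x‖² ≤ ‖Mx‖² ≤ (1+δ)‖x‖² for all x ∈ Σ−Σ := {u−v : u,v ∈ Σ}, where 0 ≤ δ < 1/sqrt(2) if J = 1 and 0 ≤ δ < 1/sqrt(2+J) if J ≥ 2. Then for every x₀ ∈ Σ, all reals 0 ≤ η ≤ ε, every e ∈ F with ‖e‖ ≤ η, and every x* ∈ H with ‖Mx* − (Mx₀+e)‖ ≤ ε and f(x*) ≤ f(x₀) (in particular any minimizer of f over this constraint set): ‖x*−x₀‖ ≤ ‖x*−x₀‖_Σ ≤ C·(η+ε), where C = 2·sqrt(1+δ)/(1−δ·sqrt(2)) if J = 1 and C = (1+sqrt(1+J))·sqrt(1+δ)/(1−δ·sqrt(2+J)) if J ≥ 2. -/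

import Mathlib

open scoped RealInnerProductSpace Pointwise ENNReal
open Metric

variable {H : Type*} [NormedAddCommGroup H] [InnerProductSpace ℝ H]

noncomputable def atomicNorm (A : Set H) (x : H) : ℝ≥0∞ :=
  ⨅ t : {t : ℝ // 0 ≤ t ∧ x ∈ t • closure (convexHull ℝ A)}, ENNReal.ofReal (t : ℝ)

noncomputable def coneNorm (S : Set H) (x : H) : ℝ≥0∞ :=
  atomicNorm (S ∩ sphere (0 : H) 1) x

noncomputable def gproj (e : ℕ → H) (g : Finset ℕ) (x : H) : H :=
  ∑ i ∈ g, ⟪x, e i⟫ • e i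

noncomputable def gprojS (e : ℕ → H) (Hs : Finset (Finset ℕ)) (x : H) : H :=
  ∑ g ∈ Hs, gproj e g x

def Egrp (e : ℕ → H) (G : Finset (Finset ℕ)) : Set H :=
  (Submodule.span ℝ (e '' (G.biUnion id : Finset ℕ)) : Set H)

def SigmaK (e : ℕ → H) (G : Finset (Finset ℕ)) (K : ℕ) : Set H :=
  {x : H | ∃ H' ⊆ G, H'.card ≤ K ∧ x = gprojS e H' x}

noncomputable def groupNormR (e : ℕ → H) (G : Finset (Finset ℕ)) (x : H) : ℝ :=
  ∑ g ∈ G, ‖gproj e g x‖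

open Classical in
noncomputable def groupNorm (e : ℕ → H) (G : Finset (Finset ℕ)) (x : H) : ℝ≥0∞ :=
  if x ∈ Egrp e G then ENNReal.ofReal (groupNormR e G x) else ⊤

noncomputable def dualNorm (e : ℕ → H) (G : Finset (Finset ℕ)) (x : H) : ℝ :=
  sSup ((fun g => ‖gproj e g x‖) '' (G : Set (Finset ℕ)))

noncomputable def deltaUoS (S : Set H) (x z : H) : ℝ :=
  if coneNorm S (x + z) = ⊤ then 0
  else (-⟪x, z⟫) /
    (‖x‖ * Real.sqrt ((coneNorm S (x + z)).toReal ^ 2 - ‖x‖ ^ 2 - 2 * ⟪x, z⟫))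

noncomputable def deltaAdmUoS (S T : Set H) : EReal :=
  ⨅ z : {z : H // z ∈ T ∧ z ≠ 0}, ⨆ x : {x : H // x ∈ S ∧ x ≠ 0},
    ((deltaUoS S (x : H) (z : H) : ℝ) : EReal)

variable {J : ℕ} {Hs : Fin J → Type*} [∀ j, NormedAddCommGroup (Hs j)]
  [∀ j, InnerProductSpace ℝ (Hs j)]

/-- The block structured sparsity model `Σ = Σ_1 × … × Σ_J` in the product Hilbert space. -/
def blockModel (e : ∀ j, ℕ → Hs j) (G : Fin J → Finset (Finset ℕ)) (K : Fin J → ℕ) :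
    Set (PiLp 2 Hs) :=
  {x : PiLp 2 Hs | ∀ j, x j ∈ SigmaK (e j) (G j) (K j)}

/-- The weighted block structured norm `f_w(x) = ∑ j, w j * ‖x j‖_{A_j}`. -/
noncomputable def blockNorm (e : ∀ j, ℕ → Hs j) (G : Fin J → Finset (Finset ℕ))
    (w : Fin J → ℝ) (x : PiLp 2 Hs) : ℝ≥0∞ :=
  ∑ j, ENNReal.ofReal (w j) * groupNorm (e j) (G j) (x j)

section Combinatorics

variable {ι : Type*} [DecidableEq ι]

/-- A set of `K` largest entries of `a`, together with an index of its smallest entry. -/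
lemma exists_topSet (s : Finset ι) (a : ι → ℝ) {K : ℕ} (hK : 1 ≤ K) (hKs : K ≤ s.card) :
    ∃ T ⊆ s, T.card = K ∧ ∃ i₀ ∈ T, (∀ i ∈ T, a i₀ ≤ a i) ∧ ∀ j ∈ s, j ∉ T → a j ≤ a i₀ := by
  obtain ⟨T, hT, hmax⟩ := (s.powersetCard K).exists_max_image (fun T => ∑ i ∈ T, a i)
    (Finset.powersetCard_nonempty.2 hKs)
  obtain ⟨hTs, hTK⟩ := Finset.mem_powersetCard.1 hT
  obtain ⟨i₀, hi₀, hmin⟩ := T.exists_min_image a (Finset.card_pos.1 (by omega))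
  refine ⟨T, hTs, hTK, i₀, hi₀, hmin, fun j hj hjT => ?_⟩
  have hj' : j ∉ T.erase i₀ := fun h => hjT (Finset.mem_of_mem_erase h)
  have h := hmax (insert j (T.erase i₀)) (Finset.mem_powersetCard.2
    ⟨Finset.insert_subset hj ((Finset.erase_subset _ _).trans hTs), by
      rw [Finset.card_insert_of_notMem hj', Finset.card_erase_of_mem hi₀]; omega⟩)
  simp only [Finset.sum_insert hj'] at h
  have := Finset.add_sum_erase T a hi₀
  linarith

/-- Fractional `K`-sums are at most the sum over a top set. -/
lemma sum_mul_le_sum_topSet {s T : Finset ι} {a w : ι → ℝ} {τ K : ℝ} (hTs : T ⊆ s)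
    (hK : (T.card : ℝ) = K) (hτ : 0 ≤ τ) (hT : ∀ i ∈ T, τ ≤ a i)
    (hTc : ∀ j ∈ s, j ∉ T → a j ≤ τ) (hw0 : ∀ i ∈ s, 0 ≤ w i) (hw1 : ∀ i ∈ s, w i ≤ 1)
    (hwK : ∑ i ∈ s, w i ≤ K) :
    ∑ i ∈ s, w i * a i ≤ ∑ i ∈ T, a i := by
  have h1 : ∑ i ∈ s, w i * (a i - τ) ≤ ∑ i ∈ T, (a i - τ) := by
    rw [← Finset.sum_sdiff hTs]
    have hA : ∑ i ∈ s \ T, w i * (a i - τ) ≤ 0 := Finset.sum_nonpos fun i hi => by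
      obtain ⟨hi, hiT⟩ := Finset.mem_sdiff.1 hi
      exact mul_nonpos_of_nonneg_of_nonpos (hw0 i hi) (by linarith [hTc i hi hiT])
    have hB : ∑ i ∈ T, w i * (a i - τ) ≤ ∑ i ∈ T, (a i - τ) := Finset.sum_le_sum fun i hi =>
      mul_le_of_le_one_left (by linarith [hT i hi]) (hw1 i (hTs hi))
    linarith
  simp only [mul_sub, Finset.sum_sub_distrib, ← Finset.sum_mul, Finset.sum_const,
    nsmul_eq_mul, hK] at h1
  nlinarith [mul_le_mul_of_nonneg_right hwK hτ]

/-- The sparse representation of a polytope: a fractional `K`-subset is a convex combination of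
subsets with at most `K` elements. -/
lemma sum_smul_mem_convexHull {E : Type*} [NormedAddCommGroup E] [NormedSpace ℝ E]
    (s : Finset ι) (d : ι → E) {K : ℕ} (hK : 1 ≤ K) (hKs : K ≤ s.card) {w : ι → ℝ}
    (hw0 : ∀ i ∈ s, 0 ≤ w i) (hw1 : ∀ i ∈ s, w i ≤ 1) (hwK : ∑ i ∈ s, w i ≤ K) :
    ∑ i ∈ s, w i • d i ∈
      convexHull ℝ {v | ∃ S ⊆ s, S.card ≤ K ∧ v = ∑ i ∈ S, d i} := by
  set A : Set E := {v | ∃ S ⊆ s, S.card ≤ K ∧ v = ∑ i ∈ S, d i}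
  have hfin : A.Finite := (s.powerset.finite_toSet.image fun S => ∑ i ∈ S, d i).subset <| by
    rintro v ⟨S, hS, -, rfl⟩
    exact ⟨S, by simpa using hS, rfl⟩
  by_contra hn
  obtain ⟨f, u, hfu, huw⟩ := geometric_hahn_banach_closed_point (convex_convexHull ℝ A)
    (hfin.isCompact_convexHull (𝕜 := ℝ)).isClosed hn
  obtain ⟨T, hTs, hTK, i₀, hi₀, hmin, hmax⟩ := exists_topSet s (fun i => max (f (d i)) 0) hK hKs
  have hle := sum_mul_le_sum_topSet (a := fun i => max (f (d i)) 0) (w := w) hTs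
    (congrArg Nat.cast hTK) (le_max_right _ _) hmin hmax hw0 hw1 hwK
  have hS := hfu (∑ i ∈ T with 0 < f (d i), d i) (subset_convexHull ℝ A
    ⟨_, (Finset.filter_subset _ _).trans hTs,
      (Finset.card_le_card (Finset.filter_subset _ _)).trans hTK.le, rfl⟩)
  have hsum : ∑ i ∈ T, max (f (d i)) 0 = ∑ i ∈ T with 0 < f (d i), f (d i) := by
    rw [Finset.sum_filter]
    refine Finset.sum_congr rfl fun i _ => ?_
    split_ifs with h
    · exact max_eq_left h.le
    · exact max_eq_right (not_lt.1 h)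
  have hw : ∑ i ∈ s, w i * f (d i) ≤ ∑ i ∈ s, w i * max (f (d i)) 0 :=
    Finset.sum_le_sum fun i hi => mul_le_mul_of_nonneg_left (le_max_left _ _) (hw0 i hi)
  simp only [map_sum, map_smul, smul_eq_mul] at hS huw
  linarith

end Combinatorics

lemma norm_sum_sq_of_pairwise_inner_eq_zero {ι : Type*} [DecidableEq ι] (s : Finset ι) (v : ι → H)
    (hv : (s : Set ι).Pairwise fun i j => ⟪v i, v j⟫ = 0) :
    ‖∑ i ∈ s, v i‖ ^ 2 = ∑ i ∈ s, ‖v i‖ ^ 2 := by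
  rw [← real_inner_self_eq_norm_sq, sum_inner]
  refine Finset.sum_congr rfl fun i hi => ?_
  rw [inner_sum, Finset.sum_eq_single_of_mem i hi fun j hj hji => hv hi hj hji.symm,
    real_inner_self_eq_norm_sq]

section ConeNorm

lemma ofReal_norm_le_coneNorm (S : Set H) (x : H) : ENNReal.ofReal ‖x‖ ≤ coneNorm S x := by
  refine le_iInf fun ⟨t, ht, hx⟩ => ENNReal.ofReal_le_ofReal ?_
  obtain ⟨y, hy, rfl⟩ := hx
  have hsub : closure (convexHull ℝ (S ∩ sphere (0 : H) 1)) ⊆ closedBall 0 1 :=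
    closure_minimal (convexHull_min (Set.inter_subset_right.trans sphere_subset_closedBall)
      (convex_closedBall (0 : H) 1)) isClosed_closedBall
  have hy1 : ‖y‖ ≤ 1 := by simpa using hsub hy
  simpa [norm_smul, abs_of_nonneg ht] using mul_le_of_le_one_right ht hy1

variable {S : Set H}

lemma mem_smul_convexHull_sphere (hS : ∀ x ∈ S, ∀ c : ℝ, c • x ∈ S) (hne : ∃ x ∈ S, ‖x‖ = 1)
    {v : H} (hv : v ∈ S) {r : ℝ} (hvr : ‖v‖ ≤ r) :
    v ∈ r • convexHull ℝ (S ∩ sphere (0 : H) 1) := by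
  have h0 : (0 : H) ∈ convexHull ℝ (S ∩ sphere (0 : H) 1) := by
    obtain ⟨x, hx, hx1⟩ := hne
    have hp : x ∈ convexHull ℝ (S ∩ sphere (0 : H) 1) := subset_convexHull ℝ _ ⟨hx, by simpa⟩
    have hn : -x ∈ convexHull ℝ (S ∩ sphere (0 : H) 1) :=
      subset_convexHull ℝ _ ⟨by simpa using hS x hx (-1), by simpa⟩
    have := convex_convexHull ℝ (S ∩ sphere (0 : H) 1) hp hn (a := 1 / 2) (b := 1 / 2)
      (by norm_num) (by norm_num) (by norm_num)
    simpa using this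
  rcases eq_or_ne v 0 with rfl | hv0
  · exact ⟨0, h0, smul_zero _⟩
  have hvpos := norm_pos_iff.2 hv0
  have hr : 0 < r := hvpos.trans_le hvr
  have hu : ‖v‖⁻¹ • v ∈ convexHull ℝ (S ∩ sphere (0 : H) 1) :=
    subset_convexHull ℝ _ ⟨hS v hv _, by simp [norm_smul, hvpos.ne']⟩
  refine ⟨(‖v‖ / r) • ‖v‖⁻¹ • v, (convex_convexHull ℝ _).smul_mem_of_zero_mem h0 hu
    ⟨by positivity, (div_le_one hr).2 hvr⟩, ?_⟩
  simp only [smul_smul]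
  rw [show r * (‖v‖ / r * ‖v‖⁻¹) = 1 by field_simp, one_smul]

/-- The atomic norm of `h + u` when `u` is a convex combination of model vectors of norm `≤ r`. -/
lemma coneNorm_add_le (hS : ∀ x ∈ S, ∀ c : ℝ, c • x ∈ S) (hne : ∃ x ∈ S, ‖x‖ = 1)
    {h u : H} (hh : h ∈ S) {r : ℝ} (hr : 0 ≤ r) (hu : u ∈ convexHull ℝ {v ∈ S | ‖v‖ ≤ r}) :
    coneNorm S (h + u) ≤ ENNReal.ofReal (‖h‖ + r) := by
  have hu' : u ∈ r • convexHull ℝ (S ∩ sphere (0 : H) 1) :=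
    convexHull_min (fun v hv => mem_smul_convexHull_sphere hS hne hv.1 hv.2)
      ((convex_convexHull ℝ _).smul r) hu
  have hz : h + u ∈ (‖h‖ + r) • convexHull ℝ (S ∩ sphere (0 : H) 1) := by
    rw [(convex_convexHull ℝ _).add_smul (norm_nonneg _) hr]
    exact Set.add_mem_add (mem_smul_convexHull_sphere hS hne hh le_rfl) hu'
  exact iInf_le_of_le ⟨‖h‖ + r, by positivity, Set.smul_set_mono subset_closure hz⟩ le_rfl

variable {F : Type*} [NormedAddCommGroup F] [InnerProductSpace ℝ F]

lemma rip_inner_ge (hS : ∀ x ∈ S, ∀ c : ℝ, c • x ∈ S) (M : H →L[ℝ] F) {δ : ℝ}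
    (hRIP : ∀ x ∈ S, ∀ y ∈ S, (1 - δ) * ‖x - y‖ ^ 2 ≤ ‖M (x - y)‖ ^ 2 ∧
      ‖M (x - y)‖ ^ 2 ≤ (1 + δ) * ‖x - y‖ ^ 2)
    {h v : H} (hh : h ∈ S) (hv : v ∈ S) (s : ℝ) :
    2 * s * ⟪h, h + v⟫ - δ * (‖h‖ ^ 2 + s ^ 2 * ‖h + v‖ ^ 2) ≤ 2 * s * ⟪M h, M (h + v)⟫ := by
  have h1 := (hRIP _ (hS h hh (1 + s)) _ (hS v hv (-s))).1
  have h2 := (hRIP _ (hS h hh (1 - s)) _ (hS v hv s)).2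
  rw [show (1 + s) • h - (-s) • v = h + s • (h + v) by module] at h1
  rw [show (1 - s) • h - s • v = h - s • (h + v) by module] at h2
  simp only [map_sub, map_add M h (s • (h + v)), map_smul M s] at h1 h2
  simp only [norm_add_sq_real h (s • _), norm_add_sq_real (M h) (s • _), norm_sub_sq_real,
    norm_smul, real_inner_smul_right, mul_pow, Real.norm_eq_abs, sq_abs] at h1 h2
  linarith

/-- Stable recovery bound for a vector split into a model part `h` and a remainder `u` in the
convex hull of model vectors of norm at most `κ * ‖h‖`. -/
lemma coneNorm_add_le_of_rip (hS : ∀ x ∈ S, ∀ c : ℝ, c • x ∈ S) (hne : ∃ x ∈ S, ‖x‖ = 1)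
    (M : H →L[ℝ] F) {δ κ : ℝ} (hδ : 0 ≤ δ) (hκ : 0 ≤ κ) (hδκ : δ * √(1 + κ ^ 2) < 1)
    (hRIP : ∀ x ∈ S, ∀ y ∈ S, (1 - δ) * ‖x - y‖ ^ 2 ≤ ‖M (x - y)‖ ^ 2 ∧
      ‖M (x - y)‖ ^ 2 ≤ (1 + δ) * ‖x - y‖ ^ 2)
    {h u : H} (hh : h ∈ S) (hu : u ∈ convexHull ℝ {v ∈ S | ‖v‖ ≤ κ * ‖h‖}) (horth : ⟪h, u⟫ = 0) :
    coneNorm S (h + u) ≤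
      ENNReal.ofReal ((1 + κ) * √(1 + δ) / (1 - δ * √(1 + κ ^ 2)) * ‖M (h + u)‖) := by
  refine (coneNorm_add_le hS hne hh (by positivity) hu).trans (ENNReal.ofReal_le_ofReal ?_)
  set q := √(1 + κ ^ 2)
  have hq0 : 0 < q := by positivity
  have hq2 : q ^ 2 = 1 + κ ^ 2 := Real.sq_sqrt (by positivity)
  let L : H →ₗ[ℝ] ℝ := (2 * q) • ((innerSL ℝ (M h)).toLinearMap ∘ₗ M.toLinearMap)
    - (2 * q - 2 * δ) • (innerSL ℝ h).toLinearMap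
  have hL : ∀ v, L v = 2 * q * ⟪M h, M v⟫ - (2 * q - 2 * δ) * ⟪h, v⟫ := fun v => by simp [L]
  have hhalf : u ∈ {v | 2 * q * ‖h‖ ^ 2 - 2 * δ * q ^ 2 * ‖h‖ ^ 2 - 2 * q * ‖M h‖ ^ 2 ≤ L v} := by
    refine convexHull_min (fun v hv => ?_) (convex_halfSpace_ge L.isLinear _) hu
    have hrip := rip_inner_ge hS M hRIP hh hv.1 q⁻¹
    have hv2 : ‖v‖ ^ 2 ≤ κ ^ 2 * ‖h‖ ^ 2 := by
      rw [← mul_pow]; exact pow_le_pow_left₀ (norm_nonneg _) hv.2 2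
    have hrip' := mul_le_mul_of_nonneg_left hrip (sq_nonneg q)
    have e1 : ∀ x y : ℝ, q ^ 2 * (2 * q⁻¹ * x - δ * (‖h‖ ^ 2 + q⁻¹ ^ 2 * y)) =
        2 * q * x - δ * (q ^ 2 * ‖h‖ ^ 2 + y) := fun x y => by field_simp
    have e2 : ∀ x : ℝ, q ^ 2 * (2 * q⁻¹ * x) = 2 * q * x := fun x => by field_simp
    rw [e1, e2, norm_add_sq_real, map_add, inner_add_right, inner_add_right,
      real_inner_self_eq_norm_sq, real_inner_self_eq_norm_sq] at hrip'
    rw [Set.mem_ofPred_eq, hL]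
    have hδv : δ * (‖h‖ ^ 2 + ‖v‖ ^ 2) ≤ δ * (q ^ 2 * ‖h‖ ^ 2) :=
      mul_le_mul_of_nonneg_left (by rw [hq2]; linarith) hδ
    linarith
  rw [Set.mem_ofPred_eq, hL, horth] at hhalf
  have hinner : (1 - δ * q) * ‖h‖ ^ 2 ≤ ⟪M h, M (h + u)⟫ := by
    rw [map_add, inner_add_right, real_inner_self_eq_norm_sq]
    refine le_of_mul_le_mul_left ?_ (show 0 < 2 * q by positivity)
    linarith
  have hMh : ‖M h‖ ≤ √(1 + δ) * ‖h‖ := by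
    have h0 : (0 : H) ∈ S := by simpa using hS h hh 0
    have := (hRIP h hh 0 h0).2
    rw [sub_zero] at this
    rw [← Real.sqrt_sq (norm_nonneg h), ← Real.sqrt_mul (by positivity)]
    exact Real.le_sqrt_of_sq_le this
  have hD : 0 < 1 - δ * q := by linarith
  have hbound : (1 - δ * q) * ‖h‖ ≤ √(1 + δ) * ‖M (h + u)‖ := by
    rcases (norm_nonneg h).eq_or_lt with h0 | h0
    · rw [← h0, mul_zero]; positivity
    · refine le_of_mul_le_mul_left ?_ h0
      calc ‖h‖ * ((1 - δ * q) * ‖h‖) = (1 - δ * q) * ‖h‖ ^ 2 := by ring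
        _ ≤ ‖M h‖ * ‖M (h + u)‖ := hinner.trans (real_inner_le_norm _ _)
        _ ≤ √(1 + δ) * ‖h‖ * ‖M (h + u)‖ := by gcongr
        _ = ‖h‖ * (√(1 + δ) * ‖M (h + u)‖) := by ring
  calc ‖h‖ + κ * ‖h‖ = (1 + κ) * ‖h‖ := by ring
    _ ≤ (1 + κ) * (√(1 + δ) * ‖M (h + u)‖ / (1 - δ * q)) := by
        gcongr; rw [le_div_iff₀ hD]; linarith
    _ = _ := by ring

end ConeNorm

section Group

/-- The group projection as a linear map. -/
noncomputable def gprojLin (e : ℕ → H) (g : Finset ℕ) : H →ₗ[ℝ] H where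
  toFun := gproj e g
  map_add' x y := by simp [gproj, inner_add_left, add_smul, Finset.sum_add_distrib]
  map_smul' c x := by simp [gproj, real_inner_smul_left, Finset.smul_sum, smul_smul]

lemma gprojLin_apply (e : ℕ → H) (g : Finset ℕ) (x : H) : gprojLin e g x = gproj e g x := rfl

variable {e : ℕ → H} {G : Finset (Finset ℕ)} {K : ℕ}

lemma gproj_mem_Egrp {g : Finset ℕ} (hg : g ∈ G) (x : H) : gproj e g x ∈ Egrp e G :=
  Submodule.sum_mem _ fun i hi => Submodule.smul_mem _ _ <| Submodule.subset_span
    ⟨i, by simpa using ⟨g, hg, hi⟩, rfl⟩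

lemma SigmaK_subset_Egrp : SigmaK e G K ⊆ Egrp e G := by
  rintro x ⟨H', hH', -, hx⟩
  rw [hx]
  exact Submodule.sum_mem _ fun g hg => gproj_mem_Egrp (hH' hg) x

lemma smul_mem_SigmaK {x : H} (hx : x ∈ SigmaK e G K) (c : ℝ) : c • x ∈ SigmaK e G K := by
  obtain ⟨H', hH', hK, hx⟩ := hx
  refine ⟨H', hH', hK, ?_⟩
  conv_lhs => rw [hx]
  simp only [gprojS, ← gprojLin_apply, map_smul, Finset.smul_sum]

lemma inner_gproj_eq_zero (he : Orthonormal ℝ e) {g g' : Finset ℕ} (h : Disjoint g g') (x y : H) :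
    ⟪gproj e g x, gproj e g' y⟫ = 0 := by
  simp only [gproj, sum_inner, inner_sum, real_inner_smul_left, real_inner_smul_right]
  refine Finset.sum_eq_zero fun k hk => Finset.sum_eq_zero fun i hi => ?_
  have hik : i ≠ k := by rintro rfl; exact Finset.disjoint_left.1 h hi hk
  rw [he.2 hik]
  ring

lemma gproj_basis (he : Orthonormal ℝ e) (g : Finset ℕ) (k : ℕ) :
    gproj e g (e k) = if k ∈ g then e k else 0 := by
  simp [gproj, orthonormal_iff_ite.1 he]

lemma gproj_gproj (he : Orthonormal ℝ e) (g g' : Finset ℕ) (x : H) :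
    gproj e g (gproj e g' x) = gproj e (g' ∩ g) x := by
  conv_lhs => rw [← gprojLin_apply, show gproj e g' x = ∑ i ∈ g', ⟪x, e i⟫ • e i from rfl]
  simp only [map_sum, map_smul, gprojLin_apply, gproj_basis he, smul_ite, smul_zero,
    Finset.sum_ite_mem]
  rfl

lemma groupNormR_nonneg (x : H) : 0 ≤ groupNormR e G x :=
  Finset.sum_nonneg fun _ _ => norm_nonneg _

lemma gproj_empty (x : H) : gproj e ∅ x = 0 := by simp [gproj]

lemma sum_gproj_eq_self (he : Orthonormal ℝ e)
    (hG : (G : Set (Finset ℕ)).Pairwise fun g g' => Disjoint g g') {x : H}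
    (hx : x ∈ Egrp e G) : ∑ g ∈ G, gproj e g x = x := by
  have hx' : x ∈ Submodule.span ℝ (e '' (G.biUnion id : Finset ℕ)) := hx
  have heq : Set.EqOn (∑ g ∈ G, gprojLin e g : H →ₗ[ℝ] H) (LinearMap.id : H →ₗ[ℝ] H)
      (e '' (G.biUnion id : Finset ℕ) : Set H) := by
    rintro _ ⟨i, hi, rfl⟩
    obtain ⟨g, hg, hig⟩ : ∃ g ∈ G, i ∈ g := by simpa using hi
    rw [LinearMap.sum_apply, Finset.sum_eq_single_of_mem g hg]
    · simp [gprojLin_apply, gproj_basis he, hig]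
    · intro g' hg' hne
      rw [gprojLin_apply, gproj_basis he, if_neg]
      exact Finset.disjoint_left.1 (hG hg hg' hne.symm) hig
  simpa [gprojLin_apply] using LinearMap.eqOn_span heq hx'

/-- A combination of at most `K` group components belongs to the group-sparse model. -/
lemma sum_smul_gproj_mem_SigmaK (he : Orthonormal ℝ e)
    (hG : (G : Set (Finset ℕ)).Pairwise fun g g' => Disjoint g g') {S : Finset (Finset ℕ)}
    (hS : S ⊆ G) (hSK : S.card ≤ K) (c : Finset ℕ → ℝ) (z : H) :
    ∑ g ∈ S, c g • gproj e g z ∈ SigmaK e G K := by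
  refine ⟨S, hS, hSK, Finset.sum_congr rfl fun g hg => ?_⟩
  rw [← gprojLin_apply, ← gprojLin_apply, map_sum, Finset.sum_eq_single_of_mem g hg]
  · rw [map_smul, gprojLin_apply, gprojLin_apply, gproj_gproj he, Finset.inter_self]
  · intro g' hg' hne
    rw [map_smul, gprojLin_apply, gproj_gproj he,
      Finset.disjoint_iff_inter_eq_empty.1 (hG (hS hg') (hS hg) hne), gproj_empty, smul_zero]

lemma norm_sum_smul_gproj_sq (he : Orthonormal ℝ e)
    (hG : (G : Set (Finset ℕ)).Pairwise fun g g' => Disjoint g g') {S : Finset (Finset ℕ)}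
    (hS : S ⊆ G) (c : Finset ℕ → ℝ) (z : H) :
    ‖∑ g ∈ S, c g • gproj e g z‖ ^ 2 = ∑ g ∈ S, ‖c g • gproj e g z‖ ^ 2 :=
  norm_sum_sq_of_pairwise_inner_eq_zero S _ fun g hg g' hg' hne => by
    beta_reduce
    rw [real_inner_smul_left, real_inner_smul_right,
      inner_gproj_eq_zero he (hG (hS hg) (hS hg') hne), mul_zero, mul_zero]

/-- A vector with group norms at most `β` and group norm sum at most `K * β` is a convex
combination of `K`-group-sparse vectors of norm at most `√K * β`. -/
lemma sum_gproj_mem_convexHull (he : Orthonormal ℝ e)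
    (hG : (G : Set (Finset ℕ)).Pairwise fun g g' => Disjoint g g') (hK : 1 ≤ K)
    (hKG : K ≤ G.card) {U : Finset (Finset ℕ)} (hU : U ⊆ G) (z : H) {β : ℝ} (hβ : 0 ≤ β)
    (hmax : ∀ g ∈ U, ‖gproj e g z‖ ≤ β) (hsum : ∑ g ∈ U, ‖gproj e g z‖ ≤ K * β) :
    ∑ g ∈ U, gproj e g z ∈ convexHull ℝ {v ∈ SigmaK e G K | ‖v‖ ≤ √K * β} := by
  let w : Finset ℕ → ℝ := fun g => if g ∈ U then ‖gproj e g z‖ / β else 0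
  have hw0 : ∀ g ∈ G, 0 ≤ w g := fun g _ => by
    simp only [w]; split_ifs <;> positivity
  have hw1 : ∀ g ∈ G, w g ≤ 1 := fun g _ => by
    simp only [w]; split_ifs with h
    · exact div_le_one_of_le₀ (hmax g h) hβ
    · exact zero_le_one
  have hwK : ∑ g ∈ G, w g ≤ K := by
    simp only [w, Finset.sum_ite_mem, Finset.inter_eq_right.2 hU, ← Finset.sum_div]
    exact div_le_of_le_mul₀ hβ (by positivity) hsum
  have key := sum_smul_mem_convexHull G (fun g => (β / ‖gproj e g z‖) • gproj e g z) hK hKG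
    hw0 hw1 hwK
  have heq : ∑ g ∈ G, w g • (β / ‖gproj e g z‖) • gproj e g z = ∑ g ∈ U, gproj e g z := by
    simp only [w, ite_smul, zero_smul, Finset.sum_ite_mem, Finset.inter_eq_right.2 hU]
    refine Finset.sum_congr rfl fun g hg => ?_
    rcases eq_or_ne (gproj e g z) 0 with h0 | h0
    · simp [h0]
    · have hn := norm_pos_iff.2 h0
      have hβ' := hn.trans_le (hmax g hg)
      rw [smul_smul, show ‖gproj e g z‖ / β * (β / ‖gproj e g z‖) = 1 by field_simp, one_smul]
  rw [heq] at key
  refine convexHull_mono ?_ key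
  rintro _ ⟨S, hS, hSK, rfl⟩
  refine ⟨sum_smul_gproj_mem_SigmaK he hG hS hSK _ z, ?_⟩
  refine le_of_sq_le_sq ?_ (by positivity)
  rw [norm_sum_smul_gproj_sq he hG hS, mul_pow, Real.sq_sqrt (by positivity)]
  have hterm : ∀ g ∈ S, ‖(β / ‖gproj e g z‖) • gproj e g z‖ ^ 2 ≤ β ^ 2 := fun g _ => by
    refine pow_le_pow_left₀ (norm_nonneg _) ?_ 2
    rw [norm_smul, norm_div, norm_norm, Real.norm_of_nonneg hβ]
    rcases eq_or_ne ‖gproj e g z‖ 0 with h0 | h0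
    · rwa [h0, mul_zero]
    · rw [div_mul_cancel₀ _ h0]
  calc _ ≤ S.card • β ^ 2 := Finset.sum_le_card_nsmul _ _ _ hterm
    _ ≤ K * β ^ 2 := by rw [nsmul_eq_mul]; gcongr

/-- The splitting of a descent direction of the group norm into its `K` largest groups and the
remainder. -/
lemma exists_group_split (he : Orthonormal ℝ e)
    (hG : (G : Set (Finset ℕ)).Pairwise fun g g' => Disjoint g g') (hK : 1 ≤ K)
    (hKG : K ≤ G.card) {z x₀ : H} (hz : z ∈ Egrp e G) (hx₀ : x₀ ∈ SigmaK e G K) :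
    ∃ (h u : H) (a b : ℝ), z = h + u ∧ h ∈ SigmaK e G K ∧ ⟪h, u⟫ = 0 ∧ 0 ≤ a ∧ 0 ≤ b ∧ b ≤ ‖h‖ ∧
      u ∈ convexHull ℝ {v ∈ SigmaK e G K | ‖v‖ ≤ max a b} ∧
      1 / √K * groupNormR e G x₀ + a ≤ 1 / √K * groupNormR e G (x₀ + z) + b := by
  obtain ⟨T, hTG, hTK, g₀, hg₀, hmin, hmax⟩ := exists_topSet G (fun g => ‖gproj e g z‖) hK hKG
  have hK0 : (0 : ℝ) < K := by exact_mod_cast hK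
  have hq0 : 0 < √(K : ℝ) := Real.sqrt_pos.2 hK0
  have hq2 : √(K : ℝ) * √K = K := Real.mul_self_sqrt hK0.le
  set A := ∑ g ∈ G \ T, ‖gproj e g z‖
  set B := ∑ g ∈ T, ‖gproj e g z‖
  have hA0 : 0 ≤ A := Finset.sum_nonneg fun _ _ => norm_nonneg _
  have hB0 : 0 ≤ B := Finset.sum_nonneg fun _ _ => norm_nonneg _
  have hKτ : K * ‖gproj e g₀ z‖ ≤ B := by
    rw [← hTK, ← nsmul_eq_mul]; exact Finset.card_nsmul_le_sum _ _ _ hmin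
  refine ⟨∑ g ∈ T, gproj e g z, ∑ g ∈ G \ T, gproj e g z, A / √K, B / √K, ?_, ?_, ?_,
    by positivity, by positivity, ?_, ?_, ?_⟩
  · rw [add_comm, Finset.sum_sdiff hTG, sum_gproj_eq_self he hG hz]
  · simpa using sum_smul_gproj_mem_SigmaK he hG hTG hTK.le (fun _ => 1) z
  · simp only [sum_inner, inner_sum]
    refine Finset.sum_eq_zero fun g' hg' => Finset.sum_eq_zero fun g hg => ?_
    obtain ⟨hg'G, hg'T⟩ := Finset.mem_sdiff.1 hg'
    exact inner_gproj_eq_zero he (hG (hTG hg) hg'G fun h => hg'T (h ▸ hg)) _ _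
  · refine le_of_sq_le_sq ?_ (norm_nonneg _)
    have hsq := norm_sum_smul_gproj_sq he hG hTG (fun _ => 1) z
    simp only [one_smul] at hsq
    rw [hsq, div_pow, Real.sq_sqrt hK0.le, div_le_iff₀ hK0, mul_comm, ← hTK]
    exact sq_sum_le_card_mul_sum_sq
  · have hmem := sum_gproj_mem_convexHull he hG hK hKG (Finset.sdiff_subset (s := G) (t := T)) z
      (β := max (A / K) (B / K)) (by positivity)
      (fun g hg => le_max_of_le_right <| by
        obtain ⟨hg, hgT⟩ := Finset.mem_sdiff.1 hg
        rw [le_div_iff₀ hK0]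
        nlinarith [hmax g hg hgT])
      (by
        have := le_max_left (A / K) (B / K)
        rwa [div_le_iff₀' hK0] at this)
    have hconv : ∀ x : ℝ, √(K : ℝ) * (x / K) = x / √K := fun x => by
      rw [eq_div_iff hq0.ne', mul_right_comm, hq2, mul_div_cancel₀ _ hK0.ne']
    rwa [mul_max_of_nonneg _ _ hq0.le, hconv, hconv] at hmem
  · obtain ⟨S, hSG, hSK, hx₀⟩ := hx₀
    have hSB : ∑ g ∈ S, ‖gproj e g z‖ ≤ B := by
      have := sum_mul_le_sum_topSet (a := fun g => ‖gproj e g z‖)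
        (w := fun g => if g ∈ S then 1 else 0) hTG (congrArg Nat.cast hTK) (norm_nonneg _)
        hmin hmax (fun g _ => by positivity) (fun g _ => by split_ifs <;> norm_num)
        (by simpa [Finset.inter_eq_right.2 hSG] using hSK)
      simpa [Finset.inter_eq_right.2 hSG] using this
    have hoff : ∀ g ∈ G, g ∉ S → gproj e g x₀ = 0 := fun g hg hgS => by
      rw [hx₀, gprojS, ← gprojLin_apply, map_sum]
      refine Finset.sum_eq_zero fun g' hg' => ?_
      rw [gprojLin_apply, gproj_gproj he, Finset.disjoint_iff_inter_eq_empty.1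
        (hG (hSG hg') hg fun h => hgS (h ▸ hg')), gproj_empty]
    have hadd : ∀ g, gproj e g (x₀ + z) = gproj e g x₀ + gproj e g z := fun g =>
      (gprojLin e g).map_add x₀ z
    have hdesc : groupNormR e G x₀ + A ≤ groupNormR e G (x₀ + z) + B := by
      have h1 : ∑ g ∈ S, ‖gproj e g x₀‖ - ∑ g ∈ S, ‖gproj e g z‖ ≤
          ∑ g ∈ S, ‖gproj e g (x₀ + z)‖ := by
        rw [← Finset.sum_sub_distrib]
        refine Finset.sum_le_sum fun g _ => ?_
        rw [hadd]
        exact norm_sub_le_norm_add _ _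
      have h2 : ∑ g ∈ G \ S, ‖gproj e g (x₀ + z)‖ = ∑ g ∈ G \ S, ‖gproj e g z‖ :=
        Finset.sum_congr rfl fun g hg => by
          obtain ⟨hg, hgS⟩ := Finset.mem_sdiff.1 hg
          rw [hadd, hoff g hg hgS, zero_add]
      have h3 : ∑ g ∈ G \ S, ‖gproj e g x₀‖ = 0 := Finset.sum_eq_zero fun g hg => by
        obtain ⟨hg, hgS⟩ := Finset.mem_sdiff.1 hg
        rw [hoff g hg hgS, norm_zero]
      have h4 := Finset.sum_sdiff (f := fun g => ‖gproj e g x₀‖) hSG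
      have h5 := Finset.sum_sdiff (f := fun g => ‖gproj e g (x₀ + z)‖) hSG
      have h6 := Finset.sum_sdiff (f := fun g => ‖gproj e g z‖) hSG
      have h7 := Finset.sum_sdiff (f := fun g => ‖gproj e g z‖) hTG
      simp only [groupNormR]
      linarith
    have := mul_le_mul_of_nonneg_left hdesc (one_div_nonneg.2 hq0.le)
    rw [div_eq_mul_one_div A, div_eq_mul_one_div B]
    linarith

end Group

section Block

variable {e : ∀ j, ℕ → Hs j} {G : Fin J → Finset (Finset ℕ)} {K : Fin J → ℕ}

lemma smul_mem_blockModel (x : PiLp 2 Hs) (hx : x ∈ blockModel e G K) (c : ℝ) :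
    c • x ∈ blockModel e G K := fun j => smul_mem_SigmaK (hx j) c

lemma exists_mem_blockModel_norm_eq_one (hJ : 1 ≤ J) (he : ∀ j, Orthonormal ℝ (e j))
    (hGne : ∀ j, ∀ g ∈ G j, g.Nonempty) (hK1 : ∀ j, 1 ≤ K j) (hKG : ∀ j, K j ≤ (G j).card) :
    ∃ x ∈ blockModel e G K, ‖x‖ = 1 := by
  let j₀ : Fin J := ⟨0, hJ⟩
  obtain ⟨g, hg⟩ := Finset.card_pos.1 (lt_of_lt_of_le (hK1 j₀) (hKG j₀))
  obtain ⟨i, hi⟩ := hGne j₀ g hg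
  refine ⟨PiLp.single 2 j₀ (e j₀ i), fun j => ?_, ?_⟩
  · rcases eq_or_ne j j₀ with rfl | hj
    · refine ⟨{g}, by simpa using hg, by simpa using hK1 j₀, ?_⟩
      simp [gprojS, gproj_basis (he j₀), hi]
    · exact ⟨∅, by simp, by simp, by simp [gprojS, hj]⟩
  · rw [PiLp.norm_single, (he j₀).1 i]

lemma toLp_mem_convexHull_blockModel {u : ∀ j, Hs j} {r : Fin J → ℝ} {R : ℝ} (hR : 0 ≤ R)
    (hrR : ∑ j, r j ^ 2 ≤ R ^ 2)
    (hu : ∀ j, u j ∈ convexHull ℝ {v ∈ SigmaK (e j) (G j) (K j) | ‖v‖ ≤ r j}) :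
    WithLp.toLp 2 u ∈ convexHull ℝ {v ∈ blockModel e G K | ‖v‖ ≤ R} := by
  have hpi : u ∈ convexHull ℝ
      (Set.univ.pi fun j => {v ∈ SigmaK (e j) (G j) (K j) | ‖v‖ ≤ r j}) := by
    rw [convexHull_pi]
    exact fun j _ => hu j
  have himg := Set.mem_image_of_mem
    (WithLp.linearEquiv 2 ℝ (∀ j, Hs j)).symm.toLinearMap hpi
  rw [LinearMap.image_convexHull] at himg
  refine convexHull_mono ?_ himg
  rintro _ ⟨v, hv, rfl⟩
  refine ⟨fun j => (hv j trivial).1, le_of_sq_le_sq ?_ hR⟩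
  rw [PiLp.norm_sq_eq_of_L2]
  exact (Finset.sum_le_sum fun j _ =>
    pow_le_pow_left₀ (norm_nonneg _) (hv j trivial).2 2).trans hrR

lemma blockNorm_eq_ofReal {w : Fin J → ℝ} (hw : ∀ j, 0 ≤ w j) {x : PiLp 2 Hs}
    (hx : ∀ j, x j ∈ Egrp (e j) (G j)) :
    blockNorm e G w x = ENNReal.ofReal (∑ j, w j * groupNormR (e j) (G j) (x j)) := by
  rw [ENNReal.ofReal_sum_of_nonneg fun j _ => mul_nonneg (hw j) (groupNormR_nonneg _)]
  refine Finset.sum_congr rfl fun j _ => ?_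
  rw [groupNorm, if_pos (hx j), ENNReal.ofReal_mul (hw j)]

lemma mem_Egrp_of_blockNorm_ne_top {w : Fin J → ℝ} (hw : ∀ j, 0 < w j) {x : PiLp 2 Hs}
    (hx : blockNorm e G w x ≠ ⊤) (j : Fin J) : x j ∈ Egrp (e j) (G j) := by
  by_contra hj
  have := ENNReal.sum_ne_top.1 hx j (Finset.mem_univ j)
  rw [groupNorm, if_neg hj] at this
  exact this (ENNReal.mul_top (by simpa using hw j))

lemma sum_max_sq_le {a b t : Fin J → ℝ} (ha : ∀ j, 0 ≤ a j) (hb : ∀ j, 0 ≤ b j)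
    (hbt : ∀ j, b j ≤ t j) (hab : ∑ j, a j ≤ ∑ j, b j) :
    ∑ j, max (a j) (b j) ^ 2 ≤ (if J = 1 then 1 else 1 + (J : ℝ)) * ∑ j, t j ^ 2 := by
  have hbt2 : ∀ j, b j ^ 2 ≤ t j ^ 2 := fun j => pow_le_pow_left₀ (hb j) (hbt j) 2
  split_ifs with hJ
  · subst hJ
    simp only [Fin.sum_univ_one] at hab ⊢
    rw [max_eq_right hab, one_mul]
    exact hbt2 0
  · have hmax : ∀ j, max (a j) (b j) ^ 2 ≤ a j ^ 2 + b j ^ 2 := fun j => by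
      rcases max_cases (a j) (b j) with ⟨h, -⟩ | ⟨h, -⟩ <;> rw [h] <;>
        nlinarith [sq_nonneg (a j), sq_nonneg (b j)]
    have hb2 : ∑ j, b j ^ 2 ≤ ∑ j, t j ^ 2 := Finset.sum_le_sum fun j _ => hbt2 j
    have ha2 : ∑ j, a j ^ 2 ≤ (∑ j, a j) ^ 2 :=
      Finset.sum_sq_le_sq_sum_of_nonneg fun j _ => ha j
    have hab2 : (∑ j, a j) ^ 2 ≤ (∑ j, b j) ^ 2 :=
      pow_le_pow_left₀ (Finset.sum_nonneg fun j _ => ha j) hab 2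
    have hcs : (∑ j, b j) ^ 2 ≤ J * ∑ j, b j ^ 2 := by
      simpa using sq_sum_le_card_mul_sum_sq (s := Finset.univ) (f := b)
    have hJb := mul_le_mul_of_nonneg_left hb2 (Nat.cast_nonneg (α := ℝ) J)
    calc ∑ j, max (a j) (b j) ^ 2 ≤ ∑ j, (a j ^ 2 + b j ^ 2) := Finset.sum_le_sum fun j _ => hmax j
      _ = ∑ j, a j ^ 2 + ∑ j, b j ^ 2 := Finset.sum_add_distrib
      _ ≤ _ := by linarith

end Block

theorem stmt16 [∀ j, CompleteSpace (Hs j)] (hJ : 1 ≤ J)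
    {F : Type*} [NormedAddCommGroup F] [InnerProductSpace ℝ F] [CompleteSpace F]
    (e : ∀ j, ℕ → Hs j) (he : ∀ j, Orthonormal ℝ (e j))
    (htot : ∀ j, (Submodule.span ℝ (Set.range (e j))).topologicalClosure = ⊤)
    (G : Fin J → Finset (Finset ℕ)) (hGne : ∀ j, ∀ g ∈ G j, g.Nonempty)
    (hGdisj : ∀ j, (G j : Set (Finset ℕ)).Pairwise fun g g' => Disjoint g g')
    (K : Fin J → ℕ) (hK1 : ∀ j, 1 ≤ K j) (hKG : ∀ j, K j ≤ (G j).card)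
    (M : PiLp 2 Hs →L[ℝ] F) (δ : ℝ) (hδ0 : 0 ≤ δ)
    (hδlt : δ < if J = 1 then 1 / Real.sqrt 2 else 1 / Real.sqrt (2 + (J : ℝ)))
    (hRIP : ∀ x ∈ blockModel e G K, ∀ y ∈ blockModel e G K,
      (1 - δ) * ‖x - y‖ ^ 2 ≤ ‖M (x - y)‖ ^ 2 ∧
      ‖M (x - y)‖ ^ 2 ≤ (1 + δ) * ‖x - y‖ ^ 2) :
    ∀ x₀ ∈ blockModel e G K, ∀ η ε : ℝ, 0 ≤ η → η ≤ ε → ∀ err : F, ‖err‖ ≤ η →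
      ∀ xs : PiLp 2 Hs, ‖M xs - (M x₀ + err)‖ ≤ ε →
        blockNorm e G (fun j => 1 / Real.sqrt (K j)) xs ≤
          blockNorm e G (fun j => 1 / Real.sqrt (K j)) x₀ →
        ENNReal.ofReal ‖xs - x₀‖ ≤ coneNorm (blockModel e G K) (xs - x₀) ∧
        coneNorm (blockModel e G K) (xs - x₀) ≤
          ENNReal.ofReal ((if J = 1 then 2 * Real.sqrt (1 + δ) / (1 - δ * Real.sqrt 2)
            else (1 + Real.sqrt (1 + (J : ℝ))) * Real.sqrt (1 + δ) /
              (1 - δ * Real.sqrt (2 + (J : ℝ)))) * (η + ε)) := by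
  intro x₀ hx₀ η ε hη hηε err herr xs hxs hf
  refine ⟨ofReal_norm_le_coneNorm _ _, ?_⟩
  set κ : ℝ := if J = 1 then 1 else √(1 + (J : ℝ)) with hκ
  have hκ0 : 0 ≤ κ := by rw [hκ]; split_ifs <;> positivity
  have hκ2 : κ ^ 2 = if J = 1 then 1 else 1 + (J : ℝ) := by
    rw [hκ]; split_ifs
    · norm_num
    · exact Real.sq_sqrt (by positivity)
  have hδκ : δ * √(1 + κ ^ 2) < 1 := by
    rw [hκ2]
    split_ifs at hδlt ⊢ with h1
    · rw [lt_div_iff₀ (by positivity)] at hδlt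
      norm_num; exact hδlt
    · rw [lt_div_iff₀ (by positivity)] at hδlt
      rwa [← add_assoc, one_add_one_eq_two]
  have hC : (if J = 1 then 2 * Real.sqrt (1 + δ) / (1 - δ * Real.sqrt 2)
      else (1 + Real.sqrt (1 + (J : ℝ))) * Real.sqrt (1 + δ) /
        (1 - δ * Real.sqrt (2 + (J : ℝ)))) = (1 + κ) * √(1 + δ) / (1 - δ * √(1 + κ ^ 2)) := by
    rw [hκ2, hκ]
    split_ifs
    · norm_num
    · rw [← add_assoc, one_add_one_eq_two]
  have hw : ∀ j, 0 < 1 / √(K j : ℝ) := fun j => by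
    have : (0 : ℝ) < K j := by exact_mod_cast hK1 j
    positivity
  have hx₀E : ∀ j, x₀ j ∈ Egrp (e j) (G j) := fun j => SigmaK_subset_Egrp (hx₀ j)
  have hx₀N := blockNorm_eq_ofReal (fun j => (hw j).le) hx₀E
  have hxsE := mem_Egrp_of_blockNorm_ne_top hw
    (ne_top_of_le_ne_top (by rw [hx₀N]; exact ENNReal.ofReal_ne_top) hf)
  rw [hx₀N, blockNorm_eq_ofReal (fun j => (hw j).le) hxsE,
    ENNReal.ofReal_le_ofReal_iff (Finset.sum_nonneg fun j _ =>
      mul_nonneg (hw j).le (groupNormR_nonneg _))] at hf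
  have hzE : ∀ j, xs j - x₀ j ∈ Egrp (e j) (G j) := fun j => Submodule.sub_mem _ (hxsE j) (hx₀E j)
  choose h u a b hz hh horth ha hb hbh hu hab using fun j =>
    exists_group_split (he j) (hGdisj j) (hK1 j) (hKG j) (hzE j) (hx₀ j)
  have hab' : ∑ j, a j ≤ ∑ j, b j := by
    have := Finset.sum_le_sum fun j (_ : j ∈ Finset.univ) => hab j
    simp only [add_sub_cancel, Finset.sum_add_distrib] at this
    linarith
  have hR : ∑ j, max (a j) (b j) ^ 2 ≤ (κ * ‖(WithLp.toLp 2 h : PiLp 2 Hs)‖) ^ 2 := by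
    rw [mul_pow, hκ2, PiLp.norm_sq_eq_of_L2]
    exact sum_max_sq_le ha hb hbh hab'
  have hsplit : xs - x₀ = WithLp.toLp 2 h + WithLp.toLp 2 u := by
    ext j
    exact hz j
  have hMz : ‖M (xs - x₀)‖ ≤ η + ε := by
    rw [show M (xs - x₀) = err + (M xs - (M x₀ + err)) by rw [map_sub]; abel]
    exact (norm_add_le _ _).trans (add_le_add herr hxs)
  have key := coneNorm_add_le_of_rip smul_mem_blockModel
    (exists_mem_blockModel_norm_eq_one hJ he hGne hK1 hKG) M hδ0 hκ0 hδκ hRIP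
    (h := WithLp.toLp 2 h) (u := WithLp.toLp 2 u) hh
    (toLp_mem_convexHull_blockModel (by positivity) hR hu)
    (by rw [PiLp.inner_apply]; exact Finset.sum_eq_zero fun j _ => horth j)
  rw [← hsplit] at key
  refine key.trans (ENNReal.ofReal_le_ofReal ?_)
  rw [hC]
  have hD : 0 < 1 - δ * √(1 + κ ^ 2) := by linarith
  gcongr
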